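/- arXiv:1802.03392 — 2 statements merged into one kernel-verified Lean document; each statement's English description precedes it below -/
import Mathlib

section
/- Every non-trivial connected subgraph of the complete bipartite graph K_{2,n} is a γβ-perfect graph. -/
open SimpleGraph

/-- `D` is a dominating set of `G`: every vertex not in `D` has a neighbor in `D`. -/
def IsDomSet {V : Type*} (G : SimpleGraph V) (D : Set V) : Prop :=
  ∀ v ∉ D, ∃ u ∈ D, G.Adj u v

/-- `C` is a vertex cover of `G`: every edge has an end-vertex in `C`. -/
def IsVtxCover {V : Type*} (G : SimpleGraph V) (C : Set V) : Prop :=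
  ∀ ⦃u v : V⦄, G.Adj u v → u ∈ C ∨ v ∈ C

/-- The domination number `γ(G)`. -/
noncomputable def domNum {V : Type*} (G : SimpleGraph V) : ℕ :=
  sInf {n | ∃ D : Set V, IsDomSet G D ∧ D.ncard = n}

/-- The covering number `β(G)`. -/
noncomputable def covNum {V : Type*} (G : SimpleGraph V) : ℕ :=
  sInf {n | ∃ C : Set V, IsVtxCover G C ∧ C.ncard = n}

/-- `G` is γβ-perfect: `G` is connected, has at least two vertices, and every
connected induced subgraph with at least two vertices satisfies `γ = β`. -/
def GammaBetaPerfect {V : Type*} [Fintype V] (G : SimpleGraph V) : Prop :=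
  G.Connected ∧ 2 ≤ Fintype.card V ∧
    ∀ S : Set V, (G.induce S).Connected → 2 ≤ S.ncard →
      domNum (G.induce S) = covNum (G.induce S)

/-- `G` contains a subgraph isomorphic to `F`, i.e. there is an injective
graph homomorphism from `F` to `G`. -/
def HasSubgraphCopy {α β : Type*} (F : SimpleGraph α) (G : SimpleGraph β) : Prop :=
  ∃ f : F →g G, Function.Injective f

/-- In a connected graph with at least two vertices, every vertex cover is dominating. -/
theorem IsVtxCover.isDomSet {V : Type*} [Nontrivial V] {G : SimpleGraph V} (hG : G.Connected)
    {C : Set V} (hC : IsVtxCover G C) : IsDomSet G C := by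
  intro v hv
  obtain ⟨u, hu⟩ := hG.preconnected.exists_adj_of_nontrivial v
  exact ⟨u, (hC hu).resolve_left hv, hu.symm⟩

/-- If every dominating set is at least as large as some vertex cover, then `γ = β` in a
connected graph with at least two vertices. -/
theorem domNum_eq_covNum {V : Type*} [Nontrivial V] {G : SimpleGraph V} (hG : G.Connected)
    (h : ∀ D, IsDomSet G D → ∃ C, IsVtxCover G C ∧ C.ncard ≤ D.ncard) :
    domNum G = covNum G := by
  apply le_antisymm
  · obtain ⟨C, hC, hcard⟩ := Nat.sInf_mem (s := {n | ∃ C : Set V, IsVtxCover G C ∧ C.ncard = n})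
      ⟨_, Set.univ, fun u _ _ => Or.inl (Set.mem_univ u), rfl⟩
    exact le_of_le_of_eq (Nat.sInf_le ⟨C, hC.isDomSet hG, rfl⟩) hcard
  · obtain ⟨D, hD, hcard⟩ := Nat.sInf_mem (s := {n | ∃ D : Set V, IsDomSet G D ∧ D.ncard = n})
      ⟨_, Set.univ, fun v hv => absurd (Set.mem_univ v) hv, rfl⟩
    obtain ⟨C, hC, hle⟩ := h D hD
    exact le_trans (Nat.sInf_le ⟨C, hC, rfl⟩) (hle.trans_eq hcard)

/-- In a subgraph of a complete bipartite graph, a dominating vertex covers all edges. -/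
theorem IsDomSet.isVtxCover_singleton {V α β : Type*} {G : SimpleGraph V}
    (f : G →g completeBipartiteGraph α β) {v : V} (hv : IsDomSet G {v}) :
    IsVtxCover G {v} := by
  intro a b hab
  by_contra! hne
  obtain ⟨_, rfl, ha⟩ := hv a hne.1
  obtain ⟨_, rfl, hb⟩ := hv b hne.2
  have h₁ := f.map_adj hab
  have h₂ := f.map_adj ha
  have h₃ := f.map_adj hb
  simp only [completeBipartiteGraph_adj] at h₁ h₂ h₃
  grind

/-- The part of size two yields a vertex cover with at most two vertices. -/
theorem exists_isVtxCover_ncard_le_two {V β : Type*} {G : SimpleGraph V}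
    (f : G →g completeBipartiteGraph (Fin 2) β) (hf : Function.Injective f) :
    ∃ C, IsVtxCover G C ∧ C.ncard ≤ 2 := by
  refine ⟨f ⁻¹' Set.range Sum.inl, fun u v huv => ?_, ?_⟩
  · have h := f.map_adj huv
    simp only [completeBipartiteGraph_adj, Sum.isLeft_iff] at h
    simp only [Set.mem_preimage, Set.mem_range]
    grind
  · calc (f ⁻¹' Set.range Sum.inl).ncard
        = (f '' (f ⁻¹' Set.range Sum.inl)).ncard := (Set.ncard_image_of_injective _ hf).symm
      _ ≤ (Set.range (Sum.inl : Fin 2 → Fin 2 ⊕ β)).ncard :=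
        Set.ncard_le_ncard (Set.image_preimage_subset _ _) (Set.finite_range _)
      _ = 2 := by
        rw [← Set.image_univ, Set.ncard_image_of_injective _ Sum.inl_injective, Set.ncard_univ,
          Nat.card_fin]

/-- A connected subgraph of `K_{2,n}` with at least two vertices satisfies `γ = β`. -/
theorem domNum_eq_covNum_of_hom {V β : Type*} [Finite V] [Nontrivial V] {G : SimpleGraph V}
    (hG : G.Connected) (f : G →g completeBipartiteGraph (Fin 2) β)
    (hf : Function.Injective f) : domNum G = covNum G := by
  refine domNum_eq_covNum hG fun D hD => ?_
  by_cases h : 2 ≤ D.ncard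
  · obtain ⟨C, hC, hle⟩ := exists_isVtxCover_ncard_le_two f hf
    exact ⟨C, hC, hle.trans h⟩
  · have hpos : 0 < D.ncard := by
      rw [Set.ncard_pos]
      by_contra hempty
      obtain ⟨v⟩ := hG.nonempty
      obtain ⟨u, hu, -⟩ := hD v fun hv => hempty ⟨v, hv⟩
      exact hempty ⟨u, hu⟩
    obtain ⟨v, rfl⟩ := Set.ncard_eq_one.mp (by omega : D.ncard = 1)
    exact ⟨{v}, hD.isVtxCover_singleton f, le_rfl⟩

/-- Every non-trivial connected subgraph of `K_{2,n}` is a γβ-perfect graph. -/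
theorem subgraph_K2n_gammaBetaPerfect {V : Type*} [Fintype V] (G : SimpleGraph V) (n : ℕ)
    (f : G →g completeBipartiteGraph (Fin 2) (Fin n)) (hf : Function.Injective f)
    (hconn : G.Connected) (hnontrivial : 2 ≤ Fintype.card V) :
    GammaBetaPerfect G := by
  refine ⟨hconn, hnontrivial, fun S hS hcard => ?_⟩
  have : Nontrivial S := Set.nontrivial_coe_sort.mpr (Set.one_lt_ncard_iff_nontrivial.mp hcard)
  exact domNum_eq_covNum_of_hom hS (f.comp (Embedding.induce S).toHom)
    (hf.comp Subtype.val_injective)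
end

section
/- Let G be a connected finite simple graph containing neither C_3 nor P_6 as a subgraph, and let v_1, v_2, v_3, v_4 be the consecutive vertices of a chordless 4-cycle in G that is a proper subgraph of G. If the degree of v_1 in G is greater than 2, then v_2 and v_4 both have degree exactly 2 in G, and every vertex of G outside {v_1, v_2, v_3, v_4} has all its neighbors in {v_1, v_3}. -/
open SimpleGraph

/-- A duplicate-free list of consecutively adjacent vertices is a copy of a path graph. -/
theorem hasSubgraphCopy_pathGraph_of_isChain {V : Type*} {G : SimpleGraph V} {l : List V}
    (hl : l.IsChain G.Adj) (hnd : l.Nodup) : HasSubgraphCopy (pathGraph l.length) G := by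
  refine ⟨⟨l.get, ?_⟩, List.nodup_iff_injective_get.mp hnd⟩
  rintro ⟨i, hi⟩ ⟨j, hj⟩ hij
  have hij' : i + 1 = j ∨ j + 1 = i := by simpa [pathGraph_adj] using hij
  rcases hij' with rfl | rfl
  · exact List.isChain_iff_getElem.mp hl i hj
  · exact (List.isChain_iff_getElem.mp hl j hi).symm

/-- Three pairwise adjacent vertices form a copy of the triangle. -/
theorem hasSubgraphCopy_cycleGraph_three {V : Type*} {G : SimpleGraph V} {a b c : V}
    (hab : G.Adj a b) (hbc : G.Adj b c) (hca : G.Adj c a) :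
    HasSubgraphCopy (cycleGraph 3) G := by
  have key : ∀ i j : Fin 3, i ≠ j → G.Adj (![a, b, c] i) (![a, b, c] j) := by
    intro i j hij
    fin_cases i <;> fin_cases j <;>
      first
        | exact absurd rfl hij
        | simp [hab, hbc, hca, hab.symm, hbc.symm, hca.symm]
  refine ⟨⟨![a, b, c], fun {i j} hij => key i j hij.ne⟩, fun i j hij => ?_⟩
  by_contra h
  exact (key i j h).ne hij

/-- If a vertex of a 4-cycle has a neighbor outside the cycle, then the next vertex of the
cycle has none. -/
theorem not_adj_next_of_adj {V : Type*} {G : SimpleGraph V}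
    (hC3 : ¬ HasSubgraphCopy (cycleGraph 3) G) (hP6 : ¬ HasSubgraphCopy (pathGraph 6) G)
    {a b c d x y : V} (hnd : [a, b, c, d].Nodup)
    (hab : G.Adj a b) (hbc : G.Adj b c) (hcd : G.Adj c d) (hda : G.Adj d a)
    (hx : x ∉ [a, b, c, d]) (hy : y ∉ [a, b, c, d]) (hax : G.Adj a x) : ¬ G.Adj b y := by
  intro hby
  by_cases hxy : x = y
  · subst hxy
    exact hC3 (hasSubgraphCopy_cycleGraph_three hab hby hax.symm)
  · refine hP6 (hasSubgraphCopy_pathGraph_of_isChain (l := [x, a, d, c, b, y]) ?_ ?_)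
    · simp [hax.symm, hda.symm, hcd.symm, hbc.symm, hby]
    · simp only [List.nodup_cons, List.mem_cons, List.not_mem_nil] at *
      grind

/-- An outside neighbor of a 4-cycle has no neighbor outside the cycle. -/
theorem mem_cycle_of_adj_of_adj {V : Type*} {G : SimpleGraph V}
    (hP6 : ¬ HasSubgraphCopy (pathGraph 6) G) {a b c d x y : V} (hnd : [a, b, c, d].Nodup)
    (hab : G.Adj a b) (hbc : G.Adj b c) (hcd : G.Adj c d)
    (hx : x ∉ [a, b, c, d]) (hax : G.Adj a x) (hxy : G.Adj x y) : y ∈ [a, b, c, d] := by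
  by_contra hy
  refine hP6 (hasSubgraphCopy_pathGraph_of_isChain (l := [y, x, a, b, c, d]) ?_ ?_)
  · simp [hxy.symm, hax.symm, hab, hbc, hcd]
  · have hne := hxy.ne'
    simp only [List.nodup_cons, List.mem_cons, List.not_mem_nil] at *
    grind

/-- A nonempty set of vertices closed under adjacency is everything in a connected graph. -/
theorem SimpleGraph.Connected.forall_of_adj_closed {V : Type*} {G : SimpleGraph V}
    (hG : G.Connected) {p : V → Prop} {a : V} (ha : p a)
    (hp : ∀ u v, G.Adj u v → p u → p v) (v : V) : p v := by
  obtain ⟨w⟩ := hG.preconnected a v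
  induction w with
  | nil => exact ha
  | cons h _ ih => exact ih (hp _ _ h ha)

/-- A vertex whose neighbors are exactly two distinct vertices has degree two. -/
theorem SimpleGraph.degree_eq_two_of_forall_adj_iff {V : Type*} [Fintype V]
    {G : SimpleGraph V} [DecidableRel G.Adj] {v a b : V} (hab : a ≠ b)
    (h : ∀ u, G.Adj v u ↔ u = a ∨ u = b) : G.degree v = 2 := by
  classical
  rw [← card_neighborFinset_eq_degree, ← Finset.card_pair hab]
  congr 1
  ext u
  simp [h]

/-- Let `G` be a connected graph with no `C₃` and no `P₆` subgraph, and let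
`v₁, v₂, v₃, v₄` be the consecutive vertices of a chordless `4`-cycle which is a proper
subgraph of `G`. If `deg v₁ > 2`, then `deg v₂ = deg v₄ = 2` and every vertex outside
`{v₁, v₂, v₃, v₄}` has all its neighbors in `{v₁, v₃}`. -/
theorem chordless_four_cycle_structure {V : Type*} [Fintype V] (G : SimpleGraph V)
    [DecidableRel G.Adj] (hconn : G.Connected)
    (hC3 : ¬ HasSubgraphCopy (cycleGraph 3) G)
    (hP6 : ¬ HasSubgraphCopy (pathGraph 6) G)
    (v₁ v₂ v₃ v₄ : V)
    (hne : v₁ ≠ v₂ ∧ v₁ ≠ v₃ ∧ v₁ ≠ v₄ ∧ v₂ ≠ v₃ ∧ v₂ ≠ v₄ ∧ v₃ ≠ v₄)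
    (h12 : G.Adj v₁ v₂) (h23 : G.Adj v₂ v₃) (h34 : G.Adj v₃ v₄) (h41 : G.Adj v₄ v₁)
    (hchord13 : ¬ G.Adj v₁ v₃) (hchord24 : ¬ G.Adj v₂ v₄)
    (hproper : ({v₁, v₂, v₃, v₄} : Set V) ≠ Set.univ)
    (hdeg : 2 < G.degree v₁) :
    G.degree v₂ = 2 ∧ G.degree v₄ = 2 ∧
      ∀ v ∉ ({v₁, v₂, v₃, v₄} : Set V), ∀ u : V, G.Adj v u → u ∈ ({v₁, v₃} : Set V) := by
  classical
  obtain ⟨n12, n13, n14, n23, n24, n34⟩ := hne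
  have hnd : [v₁, v₂, v₃, v₄].Nodup := by simp [*]
  have hnd₂ : [v₁, v₄, v₃, v₂].Nodup := by simp [*, Ne.symm]
  obtain ⟨w, hw, hw'⟩ : ∃ w, G.Adj v₁ w ∧ w ∉ [v₁, v₂, v₃, v₄] := by
    by_contra! hcon
    have hsub : G.neighborFinset v₁ ⊆ {v₂, v₄} := by
      intro u hu
      rw [mem_neighborFinset] at hu
      have hu' := hcon u hu
      have := hu.ne'
      simp only [List.mem_cons, List.not_mem_nil] at hu'
      grind
    have := (Finset.card_le_card hsub).trans Finset.card_le_two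
    rw [card_neighborFinset_eq_degree] at this
    omega
  have hv₂ : ∀ y ∉ [v₁, v₂, v₃, v₄], ¬ G.Adj v₂ y := fun y hy =>
    not_adj_next_of_adj hC3 hP6 hnd h12 h23 h34 h41 hw' hy hw
  have hv₄ : ∀ y ∉ [v₁, v₂, v₃, v₄], ¬ G.Adj v₄ y := fun y hy =>
    not_adj_next_of_adj hC3 hP6 hnd₂ h41.symm h34.symm h23.symm h12.symm (by grind) (by grind) hw
  have hout : ∀ x ∉ [v₁, v₂, v₃, v₄], G.Adj v₁ x ∨ G.Adj v₃ x → ∀ y, G.Adj x y →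
      y ∈ [v₁, v₂, v₃, v₄] := by
    rintro x hx (h | h) y hxy
    · exact mem_cycle_of_adj_of_adj hP6 hnd h12 h23 h34 hx h hxy
    · have := mem_cycle_of_adj_of_adj hP6 (a := v₃) (b := v₄) (c := v₁) (d := v₂)
        (by grind) h34 h41 h12 (by grind) h hxy
      grind
  have hall : ∀ x, x ∈ [v₁, v₂, v₃, v₄] ∨ G.Adj v₁ x ∨ G.Adj v₃ x := by
    refine hconn.forall_of_adj_closed (a := v₁) (by simp) fun u x hux hu => ?_
    by_cases hx : x ∈ [v₁, v₂, v₃, v₄]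
    · exact .inl hx
    by_cases hu' : u ∈ [v₁, v₂, v₃, v₄]
    · have h₂ := hv₂ x hx
      have h₄ := hv₄ x hx
      simp only [List.mem_cons, List.not_mem_nil] at hu'
      grind
    · exact .inl (hout u hu' (hu.resolve_left hu') x hux)
  refine ⟨degree_eq_two_of_forall_adj_iff n13 fun u => ⟨fun h => ?_, ?_⟩,
    degree_eq_two_of_forall_adj_iff n13 fun u => ⟨fun h => ?_, ?_⟩, fun x hx u hxu => ?_⟩
  · have hu := by_contra fun hn => hv₂ u hn h
    have := h.ne'
    grind
  · rintro (rfl | rfl)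
    exacts [h12.symm, h23]
  · have hu := by_contra fun hn => hv₄ u hn h
    have := h.ne'
    have := fun hu : u = v₂ => hchord24 (hu ▸ h.symm)
    grind
  · rintro (rfl | rfl)
    exacts [h41, h34.symm]
  · have hx' : x ∉ [v₁, v₂, v₃, v₄] := by simpa using hx
    have hu := hout x hx' ((hall x).resolve_left hx') u hxu
    have h₂ := hv₂ x hx'
    have h₄ := hv₄ x hx'
    have := hxu.symm
    simp only [List.mem_cons, List.not_mem_nil, Set.mem_insert_iff, Set.mem_singleton_iff] at hu ⊢
    grind
end
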